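/- Let d ≥ 1, n₁,…,n_d ≥ 1, n = n₁+…+n_d. For every ε > 0 there exist δ > 0 and η > 0 (depending only on ε, d and n₁,…,n_d) such that the following holds: if φ ∈ C¹(ℝⁿ) satisfies ‖φ‖_∞ ≤ 1 and ‖∇_{x_i}φ(x)‖_{ℓ¹} ≤ 1 for every x and every block i = 1,…,d, and τ is a measurable function with ‖τ‖_∞ ≤ 1, ‖τ‖_{bmo,2} ≤ δ, and |{x : τ(x) ≠ 0}| ≤ η, then for every open set Ω ⊂ ℝⁿ of finite positive Lebesgue measure, Σ_{R dyadic rectangle, R ⊂ Ω} ‖Δ_R(φτ)‖_{L²}² ≤ ε·|Ω|. -/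

import Mathlib

open MeasureTheory ENNReal Filter

noncomputable section

/-- A dyadic cube in `ℝ^m`, recorded by its generation `k` and its corner index `j`;
it represents the set `∏ i, [j i * 2^k, (j i + 1) * 2^k)`. -/
structure DyadicCube (m : ℕ) where
  k : ℤ
  j : Fin m → ℤ

/-- The underlying set of a dyadic cube. -/
def dyadicCubeSet {m : ℕ} (c : DyadicCube m) : Set (Fin m → ℝ) :=
  {x | ∀ i, (c.j i : ℝ) * 2 ^ c.k ≤ x i ∧ x i < ((c.j i : ℝ) + 1) * 2 ^ c.k}

/-- The generation-`k` dyadic cube containing the point `x`. -/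
def dyadicCubeOf {m : ℕ} (k : ℤ) (x : Fin m → ℝ) : DyadicCube m :=
  ⟨k, fun i => ⌊x i / 2 ^ k⌋⟩

/-- `E_k f x`: the average of `f` over the generation-`k` dyadic cube containing `x`. -/
def Ek {m : ℕ} (k : ℤ) (f : (Fin m → ℝ) → ℝ) (x : Fin m → ℝ) : ℝ :=
  ⨍ y in dyadicCubeSet (dyadicCubeOf k x), f y

/-- The martingale difference operator `Δ_Q f = (E_{k-1} f - E_k f) · 1_Q`
for a dyadic cube `Q` of generation `k`. -/
def deltaQ {m : ℕ} (c : DyadicCube m) (f : (Fin m → ℝ) → ℝ) : (Fin m → ℝ) → ℝ :=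
  (dyadicCubeSet c).indicator (fun y => Ek (c.k - 1) f y - Ek c.k f y)

/-- The product space `ℝ^{n 0} × ⋯ × ℝ^{n (d-1)}`. -/
abbrev ProductSpace {d : ℕ} (n : Fin d → ℕ) : Type := ∀ i, (Fin (n i) → ℝ)

/-- A dyadic rectangle `R = Q₁ × ⋯ × Q_d`, one dyadic cube in each block. -/
abbrev DyadicRect {d : ℕ} (n : Fin d → ℕ) : Type := ∀ i, DyadicCube (n i)

/-- The underlying set of a dyadic rectangle. -/
def dyadicRectSet {d : ℕ} {n : Fin d → ℕ} (R : DyadicRect n) : Set (ProductSpace n) :=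
  {x | ∀ i, x i ∈ dyadicCubeSet (R i)}

/-- Apply the one-parameter operator `Δ_Q` in the `i`-th block of variables. -/
def deltaBlock {d : ℕ} {n : Fin d → ℕ} (i : Fin d) (c : DyadicCube (n i))
    (f : ProductSpace n → ℝ) (x : ProductSpace n) : ℝ :=
  deltaQ c (fun y => f (Function.update x i y)) (x i)

/-- The multiparameter difference operator `Δ_R = Δ_{Q₁} ⊗ ⋯ ⊗ Δ_{Q_d}`, obtained
by applying `Δ_{Q_i}` in the `i`-th block of variables. -/
def deltaR {d : ℕ} {n : Fin d → ℕ} (R : DyadicRect n) (f : ProductSpace n → ℝ) :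
    ProductSpace n → ℝ :=
  (List.finRange d).foldr (fun i g => deltaBlock i (R i) g) f

/-- The squared `L²` norm `‖g‖_{L²}²`, as an extended nonnegative real. -/
def l2normSq {d : ℕ} {n : Fin d → ℕ} (g : ProductSpace n → ℝ) : ℝ≥0∞ :=
  ∫⁻ x, ENNReal.ofReal (g x ^ 2)

/-- The multiparameter dyadic square function `S f (x) = (∑_R |Δ_R f(x)|²)^{1/2}`. -/
def squareFn {d : ℕ} {n : Fin d → ℕ} (f : ProductSpace n → ℝ) (x : ProductSpace n) : ℝ≥0∞ :=
  (∑' R : DyadicRect n, ENNReal.ofReal (deltaR R f x ^ 2)) ^ (1 / 2 : ℝ)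

/-- The dyadic product `H¹` norm `‖S f‖_{L¹}`. -/
def H1Norm {d : ℕ} {n : Fin d → ℕ} (f : ProductSpace n → ℝ) : ℝ≥0∞ :=
  ∫⁻ x, squareFn f x

/-- An axis-parallel cube in `ℝ^m` with arbitrary corner and (positive) side length. -/
structure Cube (m : ℕ) where
  corner : Fin m → ℝ
  side : ℝ
  side_pos : 0 < side

/-- The underlying set of a cube. -/
def cubeSet {m : ℕ} (c : Cube m) : Set (Fin m → ℝ) :=
  {x | ∀ i, c.corner i ≤ x i ∧ x i < c.corner i + c.side}

/-- A rectangle `R = Q₁ × ⋯ × Q_d`: an axis-parallel cube in each block. -/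
abbrev Rect {d : ℕ} (n : Fin d → ℕ) : Type := ∀ i, Cube (n i)

/-- The underlying set of a rectangle. -/
def rectSet {d : ℕ} {n : Fin d → ℕ} (R : Rect n) : Set (ProductSpace n) :=
  {x | ∀ i, x i ∈ cubeSet (R i)}

/-- The little `bmo` norm: `sup_R |R|⁻¹ ∫_R |f - f_R|` over all rectangles. -/
def bmo1 {d : ℕ} {n : Fin d → ℕ} (f : ProductSpace n → ℝ) : ℝ≥0∞ :=
  ⨆ R : Rect n,
    (volume (rectSet R))⁻¹ * ∫⁻ x in rectSet R, ENNReal.ofReal |f x - ⨍ y in rectSet R, f y|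

/-- The `L²`-based little `bmo` norm: `sup_R (|R|⁻¹ ∫_R |f - f_R|²)^{1/2}` over all
rectangles. -/
def bmo2 {d : ℕ} {n : Fin d → ℕ} (f : ProductSpace n → ℝ) : ℝ≥0∞ :=
  ⨆ R : Rect n,
    ((volume (rectSet R))⁻¹ *
      ∫⁻ x in rectSet R, ENNReal.ofReal ((f x - ⨍ y in rectSet R, f y) ^ 2)) ^ (1 / 2 : ℝ)

/-- The one-parameter `BMO` norm over all axis-parallel cubes in `ℝ^m`. -/
def bmo1Cube {m : ℕ} (g : (Fin m → ℝ) → ℝ) : ℝ≥0∞ :=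
  ⨆ Q : Cube m,
    (volume (cubeSet Q))⁻¹ * ∫⁻ x in cubeSet Q, ENNReal.ofReal |g x - ⨍ y in cubeSet Q, g y|

/-- The `L²`-based one-parameter `BMO` norm over all axis-parallel cubes in `ℝ^m`. -/
def bmo2Cube {m : ℕ} (g : (Fin m → ℝ) → ℝ) : ℝ≥0∞ :=
  ⨆ Q : Cube m,
    ((volume (cubeSet Q))⁻¹ *
      ∫⁻ x in cubeSet Q, ENNReal.ofReal ((g x - ⨍ y in cubeSet Q, g y) ^ 2)) ^ (1 / 2 : ℝ)

/-- The strong maximal function: supremum of averages of `|f|` over all rectangles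
containing the point. -/
def strongMaximal {d : ℕ} {n : Fin d → ℕ} (f : ProductSpace n → ℝ) (x : ProductSpace n) :
    ℝ≥0∞ :=
  ⨆ (R : Rect n) (_ : x ∈ rectSet R),
    (volume (rectSet R))⁻¹ * ∫⁻ y in rectSet R, ENNReal.ofReal |f y|

end

open Function

/-- Bounded measurable real functions. -/
structure BddMeas {α : Type*} [MeasurableSpace α] (f : α → ℝ) : Prop where
  meas : Measurable f
  bdd : ∃ C : ℝ, ∀ x, |f x| ≤ C

section Cubes

variable {m : ℕ}

instance : Countable (DyadicCube m) :=
  Function.Injective.countable (f := fun c : DyadicCube m => (c.k, c.j)) (by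
    rintro ⟨k, j⟩ ⟨k', j'⟩ h
    simpa using h)

lemma dyadicCubeSet_eq_pi (c : DyadicCube m) : dyadicCubeSet c =
    Set.univ.pi fun i => Set.Ico ((c.j i : ℝ) * 2 ^ c.k) (((c.j i : ℝ) + 1) * 2 ^ c.k) := by
  ext x; simp [dyadicCubeSet]

lemma measurableSet_dyadicCubeSet (c : DyadicCube m) : MeasurableSet (dyadicCubeSet c) := by
  rw [dyadicCubeSet_eq_pi]
  exact MeasurableSet.univ_pi fun _ => measurableSet_Ico

lemma volume_dyadicCubeSet (c : DyadicCube m) :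
    volume (dyadicCubeSet c) = ENNReal.ofReal ((2 : ℝ) ^ c.k) ^ m := by
  rw [dyadicCubeSet_eq_pi, volume_pi_pi]
  simp [Real.volume_Ico, add_mul]

lemma volume_dyadicCubeSet_ne_zero (c : DyadicCube m) : volume (dyadicCubeSet c) ≠ 0 := by
  rw [volume_dyadicCubeSet]
  have : (0 : ℝ) < 2 ^ c.k := by positivity
  exact pow_ne_zero _ (by simpa using this)

lemma volume_dyadicCubeSet_ne_top (c : DyadicCube m) : volume (dyadicCubeSet c) ≠ ⊤ := by
  rw [volume_dyadicCubeSet]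
  exact ENNReal.pow_ne_top ENNReal.ofReal_ne_top

lemma mem_dyadicCubeSet_iff (c : DyadicCube m) (x : Fin m → ℝ) :
    x ∈ dyadicCubeSet c ↔ dyadicCubeOf c.k x = c := by
  obtain ⟨k, j⟩ := c
  have h2 : (0 : ℝ) < 2 ^ k := by positivity
  simp only [dyadicCubeSet, dyadicCubeOf, Set.mem_ofPred_eq, DyadicCube.mk.injEq, true_and,
    funext_iff, Int.floor_eq_iff, le_div_iff₀ h2, div_lt_iff₀ h2]

lemma mem_dyadicCubeOf (k : ℤ) (x : Fin m → ℝ) : x ∈ dyadicCubeSet (dyadicCubeOf k x) :=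
  (mem_dyadicCubeSet_iff _ _).2 rfl

lemma dyadicCubeOf_eq_of_le {k l : ℤ} (hkl : k ≤ l) {x y : Fin m → ℝ}
    (h : dyadicCubeOf k x = dyadicCubeOf k y) : dyadicCubeOf l x = dyadicCubeOf l y := by
  obtain ⟨p, rfl⟩ := Int.le.dest hkl
  simp only [dyadicCubeOf, DyadicCube.mk.injEq, true_and] at h ⊢
  funext i
  have key : ∀ z : ℝ, ⌊z / 2 ^ (k + p : ℤ)⌋ = ⌊z / 2 ^ k⌋ / (2 ^ p : ℕ) := by
    intro z
    rw [← Int.floor_div_natCast, zpow_add₀ (by norm_num), ← div_div]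
    simp
  rw [key, key, congrFun h i]

lemma dyadicCubeSet_subset {c c' : DyadicCube m} (hk : c.k ≤ c'.k) {x : Fin m → ℝ}
    (hx : x ∈ dyadicCubeSet c) (hx' : x ∈ dyadicCubeSet c') :
    dyadicCubeSet c ⊆ dyadicCubeSet c' := by
  intro y hy
  rw [mem_dyadicCubeSet_iff] at *
  rw [← hx']
  exact dyadicCubeOf_eq_of_le hk (hy.trans hx.symm)

lemma iUnion_dyadicCubeSet (k : ℤ) :
    ⋃ j : Fin m → ℤ, dyadicCubeSet ⟨k, j⟩ = Set.univ := by
  refine Set.eq_univ_of_forall fun x => Set.mem_iUnion.2 ⟨_, mem_dyadicCubeOf k x⟩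

lemma pairwise_disjoint_dyadicCubeSet (k : ℤ) :
    Pairwise (Disjoint on fun j : Fin m → ℤ => dyadicCubeSet ⟨k, j⟩) := by
  intro j j' h
  refine Set.disjoint_left.2 fun x hx hx' => h ?_
  rw [mem_dyadicCubeSet_iff] at hx hx'
  simpa using hx.symm.trans hx'

lemma Ek_of_mem {c : DyadicCube m} {x : Fin m → ℝ} (hx : x ∈ dyadicCubeSet c)
    (g : (Fin m → ℝ) → ℝ) : Ek c.k g x = ⨍ y in dyadicCubeSet c, g y := by
  rw [mem_dyadicCubeSet_iff] at hx
  rw [Ek, hx]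

lemma lintegral_eq_tsum_dyadicCubeSet (k : ℤ) (F : (Fin m → ℝ) → ℝ≥0∞) :
    ∫⁻ x, F x = ∑' j : Fin m → ℤ, ∫⁻ x in dyadicCubeSet ⟨k, j⟩, F x := by
  rw [← lintegral_iUnion (fun _ => measurableSet_dyadicCubeSet _)
    (pairwise_disjoint_dyadicCubeSet k), iUnion_dyadicCubeSet, Measure.restrict_univ]

end Cubes

section BddMeas

variable {α : Type*} [MeasurableSpace α]

lemma BddMeas.integrableOn {g : α → ℝ} (hg : BddMeas g) {μ : Measure α} {s : Set α}
    (hs : μ s ≠ ⊤) : IntegrableOn g s μ := by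
  obtain ⟨C, hC⟩ := hg.bdd
  exact Measure.integrableOn_of_bounded hs hg.meas.aestronglyMeasurable
    (Filter.Eventually.of_forall hC)

lemma BddMeas.abs_average_le {g : α → ℝ} {μ : Measure α} {s : Set α}
    (hs : μ s ≠ ⊤) {C : ℝ} (hC0 : 0 ≤ C) (hC : ∀ x, |g x| ≤ C) :
    |⨍ x in s, g x ∂μ| ≤ C := by
  rw [setAverage_eq, smul_eq_mul, abs_mul, abs_inv, abs_of_nonneg measureReal_nonneg]
  have h := norm_setIntegral_le_of_norm_le_const (μ := μ) (s := s) (f := g)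
    (lt_top_iff_ne_top.2 hs) (fun x _ => hC x)
  rw [Real.norm_eq_abs] at h
  rcases eq_or_lt_of_le (measureReal_nonneg (μ := μ) (s := s)) with h0 | h0
  · rw [← h0]; simpa using hC0
  · rw [inv_mul_le_iff₀ h0, mul_comm]; exact h

/-- Pythagoras for the mean value over a set. -/
lemma lintegral_sq_sub_const {g : α → ℝ} (hg : BddMeas g) {μ : Measure α} {s : Set α}
    (hs0 : μ s ≠ 0) (hs : μ s ≠ ⊤) (a : ℝ) :
    ∫⁻ x in s, ENNReal.ofReal ((g x - a) ^ 2) ∂μ =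
      (∫⁻ x in s, ENNReal.ofReal ((g x - ⨍ y in s, g y ∂μ) ^ 2) ∂μ) +
        ∫⁻ _ in s, ENNReal.ofReal (((⨍ y in s, g y ∂μ) - a) ^ 2) ∂μ := by
  have hint : IntegrableOn g s μ := hg.integrableOn hs
  have hsq : ∀ b : ℝ, IntegrableOn (fun x => (g x - b) ^ 2) s μ := by
    intro b
    refine BddMeas.integrableOn ⟨(hg.meas.sub_const b).pow_const 2, ?_⟩ hs
    obtain ⟨C, hC⟩ := hg.bdd
    refine ⟨(C + |b|) ^ 2, fun x => ?_⟩
    rw [abs_pow]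
    gcongr
    exact (abs_sub _ _).trans (by gcongr; exact hC x)
  have hc : ∀ b : ℝ, IntegrableOn (fun _ => b) s μ := fun b => integrableOn_const hs
  have hr : μ.real s ≠ 0 := by simp [measureReal_def, ENNReal.toReal_eq_zero_iff, hs0, hs]
  have hgs : ∫ x in s, g x ∂μ = μ.real s * ⨍ y in s, g y ∂μ := by
    rw [setAverage_eq, smul_eq_mul, mul_inv_cancel_left₀ hr]
  set A := ⨍ y in s, g y ∂μ with hA
  rw [← ofReal_integral_eq_lintegral_ofReal (hsq a) (Eventually.of_forall fun _ => sq_nonneg _),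
    ← ofReal_integral_eq_lintegral_ofReal (hsq A) (Eventually.of_forall fun _ => sq_nonneg _),
    ← ofReal_integral_eq_lintegral_ofReal (hc _) (Eventually.of_forall fun _ => sq_nonneg _),
    ← ENNReal.ofReal_add (integral_nonneg fun _ => sq_nonneg _)
      (integral_nonneg fun _ => sq_nonneg _)]
  congr 1
  have h1 : ∀ x, (g x - a) ^ 2 = (g x - A) ^ 2 + (2 * (A - a) * g x +
      ((A - a) ^ 2 - 2 * (A - a) * A)) := fun x => by ring
  have h2 : IntegrableOn (fun x => 2 * (A - a) * g x) s μ := hint.const_mul _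
  have h3 : IntegrableOn (fun x => 2 * (A - a) * g x + ((A - a) ^ 2 - 2 * (A - a) * A)) s μ :=
    h2.add (hc _)
  simp_rw [h1]
  rw [integral_add (hsq A) h3,
    integral_add h2 (hc _), integral_const_mul, hgs]
  simp only [integral_const, smul_eq_mul, measureReal_restrict_apply_univ]
  ring

end BddMeas

section Averages

variable {m : ℕ}

lemma measurable_Ek_param {Z : Type*} [MeasurableSpace Z] (k : ℤ)
    {F : Z → (Fin m → ℝ) → ℝ} (hF : Measurable (uncurry F)) {p : Z → Fin m → ℝ}
    (hp : Measurable p) : Measurable fun z => Ek k (F z) (p z) := by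
  have h1 : Measurable fun q : Z × (Fin m → ℤ) =>
      ⨍ y in dyadicCubeSet ⟨k, q.2⟩, F q.1 y := by
    refine measurable_from_prod_countable_left fun j => ?_
    simp only [setAverage_eq, smul_eq_mul]
    have h := hF.stronglyMeasurable.integral_prod_right
      (ν := volume.restrict (dyadicCubeSet ⟨k, j⟩))
    exact h.measurable.const_mul _
  have h2 : Measurable fun z => (z, fun i => ⌊p z i / 2 ^ k⌋) := by
    refine measurable_id.prodMk (measurable_pi_lambda _ fun i => ?_)
    have h3 : Measurable fun z => p z i / 2 ^ k :=
      ((measurable_pi_apply i).comp hp).div_const _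
    exact h3.floor
  have h3 := h1.comp h2
  simp only [Function.comp_def] at h3
  simpa only [Ek, dyadicCubeOf] using h3

lemma abs_Ek_le (k : ℤ) {g : (Fin m → ℝ) → ℝ} {C : ℝ} (hC0 : 0 ≤ C) (hC : ∀ x, |g x| ≤ C)
    (x : Fin m → ℝ) : |Ek k g x| ≤ C :=
  BddMeas.abs_average_le (volume_dyadicCubeSet_ne_top _) hC0 hC

lemma BddMeas.exists_nonneg {α : Type*} [MeasurableSpace α] {g : α → ℝ} (hg : BddMeas g) :
    ∃ C : ℝ, 0 ≤ C ∧ ∀ x, |g x| ≤ C := by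
  obtain ⟨C, hC⟩ := hg.bdd
  exact ⟨max C 0, le_max_right _ _, fun x => (hC x).trans (le_max_left _ _)⟩

lemma BddMeas.Ek {g : (Fin m → ℝ) → ℝ} (hg : BddMeas g) (k : ℤ) : BddMeas (Ek k g) := by
  refine ⟨measurable_Ek_param k (Z := Fin m → ℝ) (F := fun _ => g) (p := id)
    (hg.meas.comp measurable_snd) measurable_id, ?_⟩
  obtain ⟨C, h0, hC⟩ := hg.exists_nonneg
  exact ⟨C, abs_Ek_le k h0 hC⟩

lemma setIntegral_dyadicCubeSet_eq_tsum (c : DyadicCube m) (l : ℤ) {g : (Fin m → ℝ) → ℝ}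
    (hg : BddMeas g) : ∫ x in dyadicCubeSet c, g x =
      ∑' j : Fin m → ℤ, ∫ x in dyadicCubeSet c ∩ dyadicCubeSet ⟨l, j⟩, g x := by
  rw [← integral_iUnion
    (fun j => (measurableSet_dyadicCubeSet c).inter (measurableSet_dyadicCubeSet _)),
    ← Set.inter_iUnion, iUnion_dyadicCubeSet, Set.inter_univ]
  · intro j j' h
    exact (pairwise_disjoint_dyadicCubeSet l h).mono Set.inter_subset_right
      Set.inter_subset_right
  · rw [← Set.inter_iUnion, iUnion_dyadicCubeSet, Set.inter_univ]
    exact hg.integrableOn (volume_dyadicCubeSet_ne_top c)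

/-- The dyadic averages of generation at most that of `c` preserve the integral over `c`. -/
lemma setIntegral_Ek {c : DyadicCube m} {l : ℤ} (hl : l ≤ c.k) {g : (Fin m → ℝ) → ℝ}
    (hg : BddMeas g) :
    ∫ x in dyadicCubeSet c, Ek l g x = ∫ x in dyadicCubeSet c, g x := by
  rw [setIntegral_dyadicCubeSet_eq_tsum c l hg, setIntegral_dyadicCubeSet_eq_tsum c l (hg.Ek l)]
  congr 1
  funext j
  rcases Set.eq_empty_or_nonempty (dyadicCubeSet c ∩ dyadicCubeSet ⟨l, j⟩) with h | ⟨x, hx, hx'⟩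
  · simp [h]
  · rw [Set.inter_eq_right.2 (dyadicCubeSet_subset hl hx' hx)]
    have h0 : volume.real (dyadicCubeSet ⟨l, j⟩) ≠ 0 := by
      simp [measureReal_def, ENNReal.toReal_eq_zero_iff, volume_dyadicCubeSet_ne_zero,
        volume_dyadicCubeSet_ne_top]
    rw [setIntegral_congr_fun (measurableSet_dyadicCubeSet _)
      (fun x hx => Ek_of_mem (c := ⟨l, j⟩) hx g), setIntegral_const, setAverage_eq, smul_eq_mul,
      smul_eq_mul, mul_inv_cancel_left₀ h0]

lemma Ek_Ek {k l : ℤ} (hl : l ≤ k) {g : (Fin m → ℝ) → ℝ} (hg : BddMeas g) :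
    Ek k (Ek l g) = Ek k g := by
  funext x
  rw [Ek, Ek, setAverage_eq, setAverage_eq, setIntegral_Ek (c := dyadicCubeOf k x) hl hg]

lemma lintegral_sub_Ek_sq_add (k : ℤ) {g : (Fin m → ℝ) → ℝ} (hg : BddMeas g) :
    (∫⁻ x, ENNReal.ofReal ((g x - Ek k g x) ^ 2)) + ∫⁻ x, ENNReal.ofReal (Ek k g x ^ 2) =
      ∫⁻ x, ENNReal.ofReal (g x ^ 2) := by
  rw [lintegral_eq_tsum_dyadicCubeSet k, lintegral_eq_tsum_dyadicCubeSet k,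
    lintegral_eq_tsum_dyadicCubeSet k, ← ENNReal.tsum_add]
  congr 1
  funext j
  have h := lintegral_sq_sub_const hg (volume_dyadicCubeSet_ne_zero ⟨k, j⟩)
    (volume_dyadicCubeSet_ne_top _) 0
  simp only [sub_zero] at h
  rw [h]
  congr 1 <;>
  · refine setLIntegral_congr_fun (measurableSet_dyadicCubeSet _) fun x hx => ?_
    simp only [Ek_of_mem (c := ⟨k, j⟩) hx g]

lemma tsum_dyadicCube (F : DyadicCube m → ℝ≥0∞) :
    ∑' c, F c = ∑' k : ℤ, ∑' j : Fin m → ℤ, F ⟨k, j⟩ := by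
  rw [← ENNReal.tsum_prod]
  exact ((⟨fun p => ⟨p.1, p.2⟩, fun c => (c.k, c.j), fun _ => rfl, fun _ => rfl⟩ :
    ℤ × (Fin m → ℤ) ≃ DyadicCube m).tsum_eq F).symm

lemma ENNReal_tsum_int_le_of_telescope {D A : ℤ → ℝ≥0∞} {N : ℝ≥0∞}
    (h : ∀ k, D k + A k = A (k - 1)) (hN : ∀ k, A k ≤ N) : ∑' k, D k ≤ N := by
  have key : ∀ (a : ℤ) (p : ℕ), (∑ k ∈ Finset.Ioc a (a + p), D k) + A (a + p) = A a := by
    intro a p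
    induction p with
    | zero => simp
    | succ p ih =>
      have : Finset.Ioc a (a + (p + 1 : ℕ)) = insert (a + p + 1) (Finset.Ioc a (a + p)) := by
        ext z; simp only [Finset.mem_Ioc, Finset.mem_insert]; push_cast; omega
      rw [this, Finset.sum_insert (by simp), add_right_comm, Nat.cast_succ, ← add_assoc, h,
        add_sub_cancel_right, add_comm, ih]
  rw [ENNReal.tsum_eq_iSup_sum]
  refine iSup_le fun s => ?_
  obtain ⟨b, hb⟩ := s.bddAbove
  obtain ⟨a, ha⟩ := s.bddBelow
  have hsub : s ⊆ Finset.Ioc (a - 1) (a - 1 + (b - (a - 1)).toNat) := by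
    intro z hz
    have h1 := hb hz
    have h2 := ha hz
    simp only [Finset.mem_Ioc]
    omega
  calc ∑ k ∈ s, D k ≤ _ := Finset.sum_le_sum_of_subset hsub
    _ ≤ _ := le_self_add
    _ = _ := key _ _
    _ ≤ N := hN _

/-- Bessel's inequality for the martingale differences of one block. -/
lemma tsum_lintegral_deltaQ_sq_le {g : (Fin m → ℝ) → ℝ} (hg : BddMeas g) :
    ∑' c, ∫⁻ x, ENNReal.ofReal (deltaQ c g x ^ 2) ≤ ∫⁻ x, ENNReal.ofReal (g x ^ 2) := by
  have h1 : ∀ c : DyadicCube m, ∫⁻ x, ENNReal.ofReal (deltaQ c g x ^ 2) =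
      ∫⁻ x in dyadicCubeSet c, ENNReal.ofReal ((Ek (c.k - 1) g x - Ek c.k g x) ^ 2) := by
    intro c
    rw [← lintegral_indicator (measurableSet_dyadicCubeSet c)]
    congr 1
    funext x
    by_cases hx : x ∈ dyadicCubeSet c <;> simp [deltaQ, hx]
  simp_rw [h1]
  rw [tsum_dyadicCube]
  simp_rw [← lintegral_eq_tsum_dyadicCubeSet]
  refine ENNReal_tsum_int_le_of_telescope (A := fun k => ∫⁻ x, ENNReal.ofReal (Ek k g x ^ 2))
    (fun k => ?_) (fun k => ?_)
  · have h := lintegral_sub_Ek_sq_add k (hg.Ek (k - 1))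
    rwa [Ek_Ek (by omega) hg] at h
  · rw [← lintegral_sub_Ek_sq_add k hg]
    exact le_add_self

end Averages

section DeltaQ

variable {m : ℕ}

lemma Ek_congr {c : DyadicCube m} {k : ℤ} (hk : k ≤ c.k) {g h : (Fin m → ℝ) → ℝ}
    (hgh : ∀ y ∈ dyadicCubeSet c, g y = h y) {x : Fin m → ℝ} (hx : x ∈ dyadicCubeSet c) :
    Ek k g x = Ek k h x := by
  rw [Ek, Ek, setAverage_eq, setAverage_eq]
  congr 1
  exact setIntegral_congr_fun (measurableSet_dyadicCubeSet _) fun y hy =>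
    hgh y (dyadicCubeSet_subset hk (mem_dyadicCubeOf k x) hx hy)

lemma deltaQ_congr {c : DyadicCube m} {g h : (Fin m → ℝ) → ℝ}
    (hgh : ∀ y ∈ dyadicCubeSet c, g y = h y) : deltaQ c g = deltaQ c h := by
  unfold deltaQ
  refine Set.indicator_congr fun x hx => ?_
  rw [Ek_congr (by omega) hgh hx, Ek_congr le_rfl hgh hx]

lemma Ek_const (k : ℤ) (a : ℝ) (x : Fin m → ℝ) : Ek k (fun _ => a) x = a :=
  setAverage_const (volume_dyadicCubeSet_ne_zero _) (volume_dyadicCubeSet_ne_top _) a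

lemma deltaQ_const (c : DyadicCube m) (a : ℝ) : deltaQ c (fun _ => a) = 0 := by
  funext x
  simp [deltaQ, Ek_const]

lemma Ek_sub (k : ℤ) {g h : (Fin m → ℝ) → ℝ} (hg : BddMeas g) (hh : BddMeas h)
    (x : Fin m → ℝ) : Ek k (fun y => g y - h y) x = Ek k g x - Ek k h x := by
  simp only [Ek, setAverage_eq, smul_eq_mul]
  rw [integral_sub (hg.integrableOn (volume_dyadicCubeSet_ne_top _))
    (hh.integrableOn (volume_dyadicCubeSet_ne_top _)), mul_sub]

lemma deltaQ_sub (c : DyadicCube m) {g h : (Fin m → ℝ) → ℝ} (hg : BddMeas g) (hh : BddMeas h)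
    (x : Fin m → ℝ) : deltaQ c (fun y => g y - h y) x = deltaQ c g x - deltaQ c h x := by
  by_cases hx : x ∈ dyadicCubeSet c
  · simp only [deltaQ, Set.indicator_of_mem hx, Ek_sub _ hg hh]
    ring
  · simp [deltaQ, hx]

end DeltaQ

section Blocks

variable {d : ℕ} {n : Fin d → ℕ}

lemma measurable_update_uncurry (i : Fin d) :
    Measurable (uncurry fun (x : ProductSpace n) (y : Fin (n i) → ℝ) => update x i y) :=
  measurable_update'

lemma BddMeas.slice {f : ProductSpace n → ℝ} (hf : BddMeas f) (i : Fin d)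
    (x : ProductSpace n) : BddMeas fun y => f (update x i y) :=
  ⟨hf.meas.comp (measurable_update x), hf.bdd.imp fun _ h _ => h _⟩

/-- The dyadic average of generation `k` in the block `i`. -/
noncomputable def blockAvg (i : Fin d) (k : ℤ) (f : ProductSpace n → ℝ) (x : ProductSpace n) : ℝ :=
  Ek k (fun y => f (update x i y)) (x i)

lemma BddMeas.blockAvg {f : ProductSpace n → ℝ} (hf : BddMeas f) (i : Fin d) (k : ℤ) :
    BddMeas (blockAvg i k f) := by
  refine ⟨measurable_Ek_param k (F := fun x y => f (update x i y))
    (hf.meas.comp (measurable_update_uncurry i)) (measurable_pi_apply i), ?_⟩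
  obtain ⟨C, h0, hC⟩ := hf.exists_nonneg
  exact ⟨C, fun x => abs_Ek_le k h0 (fun _ => hC _) _⟩

lemma BddMeas.sub {α : Type*} [MeasurableSpace α] {f g : α → ℝ} (hf : BddMeas f)
    (hg : BddMeas g) : BddMeas fun x => f x - g x := by
  refine ⟨hf.meas.sub hg.meas, ?_⟩
  obtain ⟨C, hC⟩ := hf.bdd
  obtain ⟨D, hD⟩ := hg.bdd
  exact ⟨C + D, fun x => (abs_sub _ _).trans (add_le_add (hC x) (hD x))⟩

lemma BddMeas.indicator {α : Type*} [MeasurableSpace α] {f : α → ℝ} (hf : BddMeas f)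
    {s : Set α} (hs : MeasurableSet s) : BddMeas (s.indicator f) := by
  refine ⟨hf.meas.indicator hs, ?_⟩
  obtain ⟨C, h0, hC⟩ := hf.exists_nonneg
  refine ⟨C, fun x => ?_⟩
  by_cases hx : x ∈ s <;> simp [hx, hC, h0]

lemma BddMeas.sum {α ι : Type*} [MeasurableSpace α] {s : Finset ι} {f : ι → α → ℝ}
    (hf : ∀ k, BddMeas (f k)) : BddMeas fun x => ∑ k ∈ s, f k x := by
  refine ⟨Finset.measurable_sum _ fun k _ => (hf k).meas, ?_⟩
  choose C hC using fun k => (hf k).bdd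
  exact ⟨∑ k ∈ s, C k, fun x => (Finset.abs_sum_le_sum_abs _ _).trans
    (Finset.sum_le_sum fun k _ => hC k x)⟩

lemma BddMeas.deltaBlock {f : ProductSpace n → ℝ} (hf : BddMeas f) (i : Fin d)
    (c : DyadicCube (n i)) : BddMeas (deltaBlock i c f) :=
  ((hf.blockAvg i (c.k - 1)).sub (hf.blockAvg i c.k)).indicator
    (s := (fun x : ProductSpace n => x i) ⁻¹' dyadicCubeSet c)
    (measurable_pi_apply i (measurableSet_dyadicCubeSet c))

lemma BddMeas.foldr_deltaBlock {f : ProductSpace n → ℝ} (hf : BddMeas f) (R : DyadicRect n)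
    (l : List (Fin d)) : BddMeas (l.foldr (fun i g => _root_.deltaBlock i (R i) g) f) := by
  induction l with
  | nil => exact hf
  | cons a l ih => exact ih.deltaBlock a (R a)

lemma deltaBlock_update (i : Fin d) (c : DyadicCube (n i)) (f : ProductSpace n → ℝ)
    (x : ProductSpace n) (y : Fin (n i) → ℝ) :
    deltaBlock i c f (update x i y) = deltaQ c (fun z => f (update x i z)) y := by
  simp [deltaBlock]

lemma lintegral_mono_block (i : Fin d) {F G : ProductSpace n → ℝ≥0∞} (hF : Measurable F)
    (hG : Measurable G)
    (h : ∀ x, ∫⁻ y, F (update x i y) ≤ ∫⁻ y, G (update x i y)) :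
    ∫⁻ x, F x ≤ ∫⁻ x, G x := by
  refine lintegral_le_of_lmarginal_le (μ := fun _ => volume) {i} hF hG fun x => ?_
  rw [lmarginal_singleton, lmarginal_singleton]
  exact h x

lemma BddMeas.measurable_ofReal_sq {α : Type*} [MeasurableSpace α] {f : α → ℝ}
    (hf : BddMeas f) : Measurable fun x => ENNReal.ofReal (f x ^ 2) :=
  (hf.meas.pow_const 2).ennreal_ofReal

lemma tsum_l2normSq_deltaBlock_le {f : ProductSpace n → ℝ} (hf : BddMeas f) (i : Fin d) :
    ∑' c, l2normSq (deltaBlock i c f) ≤ l2normSq f := by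
  unfold l2normSq
  rw [← lintegral_tsum fun c => (hf.deltaBlock i c).measurable_ofReal_sq.aemeasurable]
  refine lintegral_mono_block i
    (Measurable.tsum fun c => (hf.deltaBlock i c).measurable_ofReal_sq)
    hf.measurable_ofReal_sq fun x => ?_
  simp only [deltaBlock_update]
  rw [lintegral_tsum fun c => ?_]
  · exact tsum_lintegral_deltaQ_sq_le (hf.slice i x)
  · have h := ((hf.deltaBlock i c).slice i x).measurable_ofReal_sq
    simp only [deltaBlock_update] at h
    exact h.aemeasurable

lemma foldr_deltaBlock_update_of_notMem {a : Fin d} {l : List (Fin d)} (ha : a ∉ l)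
    (R : DyadicRect n) (c : DyadicCube (n a)) (f : ProductSpace n → ℝ) :
    l.foldr (fun i g => deltaBlock i (update R a c i) g) f =
      l.foldr (fun i g => deltaBlock i (R i) g) f := by
  refine List.foldr_ext _ _ _ fun i hi g => ?_
  have h : i ≠ a := fun h => ha (h ▸ hi)
  rw [update_of_ne h]

/-- Bessel's inequality for the differences taken in the blocks of a list `l`, the
cubes in the other blocks being those of `R₀`. -/
lemma tsum_l2normSq_foldr_le {f : ProductSpace n → ℝ} (hf : BddMeas f) (R₀ : DyadicRect n)
    {l : List (Fin d)} (hl : l.Nodup) :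
    ∑' R : {R : DyadicRect n // ∀ i ∉ l, R i = R₀ i},
      l2normSq (l.foldr (fun i g => deltaBlock i (R.1 i) g) f) ≤ l2normSq f := by
  induction l with
  | nil =>
    have : Subsingleton {R : DyadicRect n // ∀ i ∉ ([] : List (Fin d)), R i = R₀ i} :=
      ⟨fun R S => Subtype.ext (funext fun i => by rw [R.2 i (by simp), S.2 i (by simp)])⟩
    rw [tsum_eq_single ⟨R₀, fun _ _ => rfl⟩ fun b hb => absurd (Subsingleton.elim _ _) hb]
    exact le_rfl
  | cons a l ih =>
    obtain ⟨ha, hl⟩ := List.nodup_cons.1 hl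
    let e : {R : DyadicRect n // ∀ i ∉ a :: l, R i = R₀ i} →
        {R : DyadicRect n // ∀ i ∉ l, R i = R₀ i} × DyadicCube (n a) := fun R =>
      (⟨update R.1 a (R₀ a), fun i hi => by
        by_cases h : i = a
        · subst h; simp
        · rw [update_of_ne h]; exact R.2 i (by simp [h, hi])⟩, R.1 a)
    have he : Injective e := by
      rintro ⟨R, hR⟩ ⟨S, hS⟩ h
      simp only [e, Prod.mk.injEq, Subtype.mk.injEq] at h
      refine Subtype.ext (funext fun i => ?_)
      by_cases hi : i = a
      · subst hi; exact h.2
      · simpa [hi] using congrFun h.1 i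
    calc ∑' R : {R : DyadicRect n // ∀ i ∉ a :: l, R i = R₀ i},
          l2normSq ((a :: l).foldr (fun i g => deltaBlock i (R.1 i) g) f)
        = ∑' R : {R : DyadicRect n // ∀ i ∉ a :: l, R i = R₀ i},
          (fun p : {R : DyadicRect n // ∀ i ∉ l, R i = R₀ i} × DyadicCube (n a) =>
            l2normSq (deltaBlock a p.2
              (l.foldr (fun i g => deltaBlock i (p.1.1 i) g) f))) (e R) := by
          refine tsum_congr fun R => ?_
          simp only [e, foldr_deltaBlock_update_of_notMem ha, List.foldr_cons]
      _ ≤ ∑' p : {R : DyadicRect n // ∀ i ∉ l, R i = R₀ i} × DyadicCube (n a),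
          l2normSq (deltaBlock a p.2 (l.foldr (fun i g => deltaBlock i (p.1.1 i) g) f)) :=
          ENNReal.tsum_comp_le_tsum_of_injective he _
      _ = ∑' R : {R : DyadicRect n // ∀ i ∉ l, R i = R₀ i}, ∑' c : DyadicCube (n a),
          l2normSq (deltaBlock a c (l.foldr (fun i g => deltaBlock i (R.1 i) g) f)) :=
          ENNReal.tsum_prod'
      _ ≤ _ := ENNReal.tsum_le_tsum fun R =>
          tsum_l2normSq_deltaBlock_le (hf.foldr_deltaBlock R.1 l) a
      _ ≤ _ := ih hl

/-- Bessel's inequality for the multiparameter differences. -/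
lemma tsum_l2normSq_deltaR_le {f : ProductSpace n → ℝ} (hf : BddMeas f) :
    ∑' R : DyadicRect n, l2normSq (deltaR R f) ≤ l2normSq f := by
  let R₀ : DyadicRect n := fun _ => ⟨0, 0⟩
  let e : DyadicRect n → {R : DyadicRect n // ∀ i ∉ List.finRange d, R i = R₀ i} :=
    fun R => ⟨R, fun i hi => absurd (List.mem_finRange i) hi⟩
  have he : Injective e := fun R S h => congrArg Subtype.val h
  exact (ENNReal.tsum_comp_le_tsum_of_injective he fun R =>
    l2normSq ((List.finRange d).foldr (fun i g => deltaBlock i (R.1 i) g) f)).trans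
    (tsum_l2normSq_foldr_le hf R₀ (List.nodup_finRange d))

lemma deltaR_sub (R : DyadicRect n) {f g : ProductSpace n → ℝ} (hf : BddMeas f)
    (hg : BddMeas g) (x : ProductSpace n) :
    deltaR R (fun x => f x - g x) x = deltaR R f x - deltaR R g x := by
  unfold deltaR
  induction List.finRange d generalizing x with
  | nil => rfl
  | cons a l ih =>
    simp only [List.foldr_cons]
    rw [funext ih]
    exact deltaQ_sub _ ((hf.foldr_deltaBlock R l).slice a x) ((hg.foldr_deltaBlock R l).slice a x) _

lemma update_mem_dyadicRectSet {R : DyadicRect n} {x : ProductSpace n}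
    (hx : x ∈ dyadicRectSet R) {i : Fin d} {y : Fin (n i) → ℝ}
    (hy : y ∈ dyadicCubeSet (R i)) : update x i y ∈ dyadicRectSet R := by
  intro j
  by_cases h : j = i
  · subst h; simpa using hy
  · simpa [h] using hx j

lemma foldr_deltaBlock_eq_zero_of_notMem (R : DyadicRect n) (f : ProductSpace n → ℝ)
    {l : List (Fin d)} {x : ProductSpace n} {j : Fin d} (hj : j ∈ l)
    (hx : x j ∉ dyadicCubeSet (R j)) :
    l.foldr (fun i g => deltaBlock i (R i) g) f x = 0 := by
  induction l generalizing x with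
  | nil => simp at hj
  | cons a l ih =>
    simp only [List.foldr_cons, deltaBlock]
    by_cases h : j = a
    · subst h
      simp [deltaQ, hx]
    · have hz : (fun y => l.foldr (fun i g => deltaBlock i (R i) g) f (update x a y)) =
          fun _ => (0 : ℝ) :=
        funext fun y => ih (by simpa [h] using hj) (by simpa [h] using hx)
      rw [hz, deltaQ_const]
      rfl

lemma deltaBlock_eq_zero_of_const {R : DyadicRect n} {i : Fin d} {u : ProductSpace n → ℝ}
    (hu : ∀ x ∈ dyadicRectSet R, ∀ y ∈ dyadicCubeSet (R i), u (update x i y) = u x)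
    {x : ProductSpace n} (hx : x ∈ dyadicRectSet R) : deltaBlock i (R i) u x = 0 := by
  rw [deltaBlock, deltaQ_congr (h := fun _ => u x) (hu x hx), deltaQ_const]
  rfl

lemma deltaBlock_const_of_ne {R : DyadicRect n} {i j : Fin d} (hij : j ≠ i)
    {u : ProductSpace n → ℝ}
    (hu : ∀ x ∈ dyadicRectSet R, ∀ y ∈ dyadicCubeSet (R i), u (update x i y) = u x) :
    ∀ x ∈ dyadicRectSet R, ∀ y ∈ dyadicCubeSet (R i),
      deltaBlock j (R j) u (update x i y) = deltaBlock j (R j) u x := by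
  intro x hx y hy
  rw [deltaBlock, deltaBlock, update_of_ne hij]
  refine congrFun (deltaQ_congr fun z hz => ?_) _
  rw [update_comm hij.symm]
  exact hu _ (update_mem_dyadicRectSet hx hz) y hy

/-- `Δ_R` annihilates the functions which on `R` do not depend on one of the blocks. -/
lemma deltaR_eq_zero {R : DyadicRect n} {i : Fin d} {u : ProductSpace n → ℝ}
    (hu : ∀ x ∈ dyadicRectSet R, ∀ y ∈ dyadicCubeSet (R i), u (update x i y) = u x)
    (x : ProductSpace n) : deltaR R u x = 0 := by
  by_cases hx : x ∈ dyadicRectSet R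
  · have key : ∀ l : List (Fin d),
        (i ∉ l → ∀ x ∈ dyadicRectSet R, ∀ y ∈ dyadicCubeSet (R i),
          l.foldr (fun i g => deltaBlock i (R i) g) u (update x i y) =
            l.foldr (fun i g => deltaBlock i (R i) g) u x) ∧
        (i ∈ l → ∀ x ∈ dyadicRectSet R, l.foldr (fun i g => deltaBlock i (R i) g) u x = 0) := by
      intro l
      induction l with
      | nil => exact ⟨fun _ => hu, by simp⟩
      | cons a l ih =>
        simp only [List.foldr_cons, List.mem_cons]
        refine ⟨fun h => deltaBlock_const_of_ne (fun h' => h (Or.inl h'.symm))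
          (ih.1 fun h' => h (Or.inr h')), fun h x hx => ?_⟩
        by_cases hil : i ∈ l
        · rw [deltaBlock, deltaQ_congr (h := fun _ => 0) fun y hy =>
            ih.2 hil _ (update_mem_dyadicRectSet hx hy), deltaQ_const]
          rfl
        · obtain rfl := h.resolve_right hil
          exact deltaBlock_eq_zero_of_const (ih.1 hil) hx
    exact (key _).2 (List.mem_finRange i) x hx
  · simp only [dyadicRectSet, Set.mem_ofPred_eq, not_forall] at hx
    obtain ⟨j, hj⟩ := hx
    exact foldr_deltaBlock_eq_zero_of_notMem R u (List.mem_finRange j) hj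

end Blocks

section Rectangles

variable {d : ℕ} {n : Fin d → ℕ}

lemma dyadicRectSet_eq_pi (R : DyadicRect n) :
    dyadicRectSet R = Set.univ.pi fun i => dyadicCubeSet (R i) := by
  ext x; simp [dyadicRectSet]

lemma measurableSet_dyadicRectSet (R : DyadicRect n) : MeasurableSet (dyadicRectSet R) := by
  rw [dyadicRectSet_eq_pi]
  exact MeasurableSet.univ_pi fun _ => measurableSet_dyadicCubeSet _

lemma volume_dyadicRectSet (R : DyadicRect n) :
    volume (dyadicRectSet R) = ∏ i, volume (dyadicCubeSet (R i)) := by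
  rw [dyadicRectSet_eq_pi, volume_pi_pi]

lemma volume_dyadicRectSet_ne_zero (R : DyadicRect n) : volume (dyadicRectSet R) ≠ 0 := by
  rw [volume_dyadicRectSet]
  exact Finset.prod_ne_zero_iff.2 fun i _ => volume_dyadicCubeSet_ne_zero _

lemma volume_dyadicRectSet_ne_top (R : DyadicRect n) : volume (dyadicRectSet R) ≠ ⊤ := by
  rw [volume_dyadicRectSet]
  exact ENNReal.prod_ne_top fun i _ => volume_dyadicCubeSet_ne_top _

/-- On a union of dyadic rectangles of fixed generations, an integral bound on each of these
rectangles adds up. -/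
lemma setLIntegral_le_of_saturated (γ : Fin d → ℤ) {B : Set (ProductSpace n)}
    (hB : MeasurableSet B)
    (hsat : ∀ x z : ProductSpace n,
      (∀ j, dyadicCubeOf (γ j) (x j) = dyadicCubeOf (γ j) (z j)) → x ∈ B → z ∈ B)
    {F : ProductSpace n → ℝ≥0∞} {C : ℝ≥0∞}
    (hF : ∀ T : DyadicRect n, (∀ j, (T j).k = γ j) →
      ∫⁻ x in dyadicRectSet T, F x ≤ C * volume (dyadicRectSet T)) :
    ∫⁻ x in B, F x ≤ C * volume B := by
  let T : (∀ j, Fin (n j) → ℤ) → DyadicRect n := fun J j => ⟨γ j, J j⟩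
  have hU : ⋃ J, B ∩ dyadicRectSet (T J) = B := by
    rw [← Set.inter_iUnion, Set.inter_eq_left]
    intro x _
    exact Set.mem_iUnion.2 ⟨fun j => (dyadicCubeOf (γ j) (x j)).j, fun j => mem_dyadicCubeOf _ _⟩
  have hm : ∀ J, MeasurableSet (B ∩ dyadicRectSet (T J)) := fun J =>
    hB.inter (measurableSet_dyadicRectSet _)
  have hd : Pairwise (Disjoint on fun J => B ∩ dyadicRectSet (T J)) := by
    intro J J' h
    refine Set.disjoint_left.2 fun x hx hx' => h ?_
    funext j
    have h1 := (mem_dyadicCubeSet_iff _ _).1 (hx.2 j)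
    have h2 := (mem_dyadicCubeSet_iff _ _).1 (hx'.2 j)
    simpa [T] using h1.symm.trans h2
  have h1 : ∀ G : ProductSpace n → ℝ≥0∞,
      ∫⁻ x in B, G x = ∑' J, ∫⁻ x in B ∩ dyadicRectSet (T J), G x := by
    intro G
    rw [← lintegral_iUnion hm hd, hU]
  have h2 : C * volume B = ∑' J, C * volume (B ∩ dyadicRectSet (T J)) := by
    simpa using h1 fun _ => C
  rw [h1, h2]
  refine ENNReal.tsum_le_tsum fun J => ?_
  rcases Set.eq_empty_or_nonempty (B ∩ dyadicRectSet (T J)) with h | ⟨x, hx, hx'⟩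
  · simp [h]
  · have hsub : dyadicRectSet (T J) ⊆ B := fun z hz => hsat x z (fun j =>
      ((mem_dyadicCubeSet_iff _ _).1 (hx' j)).trans
        ((mem_dyadicCubeSet_iff _ _).1 (hz j)).symm) hx
    rw [Set.inter_eq_right.2 hsub]
    exact hF _ fun _ => rfl

end Rectangles

section StoppingSets

variable {d : ℕ} {n : Fin d → ℕ}

/-- The union of the dyadic rectangles contained in `Ω`, of generation `k` in the block `i` and of
generation at least `l` in every block. -/
def genUnion (Ω : Set (ProductSpace n)) (i : Fin d) (l k : ℤ) : Set (ProductSpace n) :=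
  ⋃ R ∈ {R : DyadicRect n | dyadicRectSet R ⊆ Ω ∧ (R i).k = k ∧ ∀ j, l ≤ (R j).k},
    dyadicRectSet R

/-- The points for which `k` is the largest generation, at most `κ`, such that they belong to
`genUnion Ω i l k`. -/
def stopSet (Ω : Set (ProductSpace n)) (i : Fin d) (l κ k : ℤ) : Set (ProductSpace n) :=
  genUnion Ω i l k \ ⋃ k' ∈ Set.Ioc k κ, genUnion Ω i l k'

variable {Ω : Set (ProductSpace n)} {i : Fin d} {l κ k k' : ℤ}

lemma mem_genUnion {x : ProductSpace n} : x ∈ genUnion Ω i l k ↔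
    ∃ R : DyadicRect n, (dyadicRectSet R ⊆ Ω ∧ (R i).k = k ∧ ∀ j, l ≤ (R j).k) ∧
      x ∈ dyadicRectSet R := by
  simp [genUnion]

lemma mem_stopSet {x : ProductSpace n} : x ∈ stopSet Ω i l κ k ↔
    x ∈ genUnion Ω i l k ∧ ∀ k', k < k' → k' ≤ κ → x ∉ genUnion Ω i l k' := by
  simp [stopSet]

lemma measurableSet_genUnion : MeasurableSet (genUnion Ω i l k) :=
  MeasurableSet.biUnion (Set.to_countable _) fun R _ => measurableSet_dyadicRectSet R

lemma measurableSet_stopSet : MeasurableSet (stopSet Ω i l κ k) :=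
  measurableSet_genUnion.diff
    (MeasurableSet.biUnion (Set.to_countable _) fun _ _ => measurableSet_genUnion)

lemma genUnion_subset : genUnion Ω i l k ⊆ Ω := by
  intro x hx
  obtain ⟨R, hR, hxR⟩ := mem_genUnion.1 hx
  exact hR.1 hxR

lemma genUnion_of_same_cube {x z : ProductSpace n}
    (hi : dyadicCubeOf k (x i) = dyadicCubeOf k (z i))
    (hj : ∀ j, j ≠ i → dyadicCubeOf l (x j) = dyadicCubeOf l (z j)) (hk : k ≤ k')
    (hx : x ∈ genUnion Ω i l k') : z ∈ genUnion Ω i l k' := by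
  obtain ⟨R, hR, hxR⟩ := mem_genUnion.1 hx
  refine mem_genUnion.2 ⟨R, hR, fun j => ?_⟩
  have hxj := (mem_dyadicCubeSet_iff _ _).1 (hxR j)
  rw [mem_dyadicCubeSet_iff, ← hxj]
  by_cases h : j = i
  · subst h
    exact dyadicCubeOf_eq_of_le (by rw [hxj, hR.2.1]; exact hk) hi.symm
  · exact dyadicCubeOf_eq_of_le (by rw [hxj]; exact hR.2.2 j) (hj j h).symm

lemma stopSet_of_same_cube {x z : ProductSpace n}
    (hi : dyadicCubeOf k (x i) = dyadicCubeOf k (z i))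
    (hj : ∀ j, j ≠ i → dyadicCubeOf l (x j) = dyadicCubeOf l (z j)) (hk : k ≤ k')
    (hx : x ∈ stopSet Ω i l κ k') : z ∈ stopSet Ω i l κ k' := by
  rw [mem_stopSet] at hx ⊢
  exact ⟨genUnion_of_same_cube hi hj hk hx.1, fun m hm hmκ hz => hx.2 m hm hmκ
    (genUnion_of_same_cube hi.symm (fun j h => (hj j h).symm) (by omega) hz)⟩

lemma eq_of_mem_stopSet {x : ProductSpace n} (hk : k ≤ κ) (hk' : k' ≤ κ)
    (hx : x ∈ stopSet Ω i l κ k) (hx' : x ∈ stopSet Ω i l κ k') : k = k' := by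
  rw [mem_stopSet] at hx hx'
  rcases lt_trichotomy k k' with h | h | h
  · exact absurd hx'.1 (hx.2 k' h hk')
  · exact h
  · exact absurd hx.1 (hx'.2 k h hk)

lemma exists_mem_stopSet {x : ProductSpace n} (hk : k ≤ κ) (hx : x ∈ genUnion Ω i l k) :
    ∃ m, k ≤ m ∧ m ≤ κ ∧ x ∈ stopSet Ω i l κ m := by
  obtain ⟨m, ⟨hmκ, hxm⟩, hmax⟩ := Int.exists_greatest_of_bdd
    (P := fun m => m ≤ κ ∧ x ∈ genUnion Ω i l m) ⟨κ, fun z hz => hz.1⟩ ⟨k, hk, hx⟩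
  refine ⟨m, hmax k ⟨hk, hx⟩, hmκ, mem_stopSet.2 ⟨hxm, fun k' h1 h2 h3 => ?_⟩⟩
  exact absurd (hmax k' ⟨h2, h3⟩) (by omega)

/-- `f` minus its average over the stopping cube in the block `i`. -/
noncomputable def stoppedOsc (Ω : Set (ProductSpace n)) (i : Fin d) (l κ : ℤ)
    (f : ProductSpace n → ℝ) (x : ProductSpace n) : ℝ :=
  ∑ k ∈ Finset.Icc l κ, (stopSet Ω i l κ k).indicator (fun x => f x - blockAvg i k f x) x

lemma BddMeas.stoppedOsc {f : ProductSpace n → ℝ} (hf : BddMeas f) :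
    BddMeas (stoppedOsc Ω i l κ f) :=
  BddMeas.sum fun k => (hf.sub (hf.blockAvg i k)).indicator measurableSet_stopSet

lemma le_of_mem_genUnion {x : ProductSpace n} (hx : x ∈ genUnion Ω i l k) : l ≤ k := by
  obtain ⟨R, hR, -⟩ := mem_genUnion.1 hx
  exact hR.2.1 ▸ hR.2.2 i

lemma stoppedOsc_of_mem {f : ProductSpace n → ℝ} {x : ProductSpace n} (hk : k ≤ κ)
    (hx : x ∈ stopSet Ω i l κ k) : stoppedOsc Ω i l κ f x = f x - blockAvg i k f x := by
  rw [stoppedOsc, Finset.sum_eq_single k]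
  · rw [Set.indicator_of_mem hx]
  · intro m hm hmk
    refine Set.indicator_of_notMem (fun h => hmk ?_) _
    exact eq_of_mem_stopSet (Finset.mem_Icc.1 hm).2 hk h hx
  · intro h
    exact absurd (Finset.mem_Icc.2 ⟨le_of_mem_genUnion (mem_stopSet.1 hx).1, hk⟩) h

lemma deltaR_stoppedOsc {f : ProductSpace n → ℝ} (hf : BddMeas f) {R : DyadicRect n}
    (hR : dyadicRectSet R ⊆ Ω) (hκ : (R i).k ≤ κ) (hl : ∀ j, l ≤ (R j).k) :
    deltaR R f = deltaR R (stoppedOsc Ω i l κ f) := by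
  funext x
  rw [← sub_eq_zero, ← deltaR_sub R hf hf.stoppedOsc]
  refine deltaR_eq_zero (i := i) (fun x hx y hy => ?_) x
  have hxA : x ∈ genUnion Ω i l (R i).k := mem_genUnion.2 ⟨R, ⟨hR, rfl, hl⟩, hx⟩
  obtain ⟨m, hkm, hmκ, hxm⟩ := exists_mem_stopSet hκ hxA
  have hcube : dyadicCubeOf (R i).k (x i) = dyadicCubeOf (R i).k (update x i y i) := by
    rw [update_self, (mem_dyadicCubeSet_iff _ _).1 (hx i), (mem_dyadicCubeSet_iff _ _).1 hy]
  have hym : update x i y ∈ stopSet Ω i l κ m :=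
    stopSet_of_same_cube hcube (fun j hj => by rw [update_of_ne hj]) hkm hxm
  rw [stoppedOsc_of_mem hmκ hxm, stoppedOsc_of_mem hmκ hym, _root_.sub_sub_cancel,
    _root_.sub_sub_cancel]
  simp only [blockAvg, Ek, dyadicCubeOf_eq_of_le hkm hcube, update_idem]

lemma l2normSq_stoppedOsc_le {f : ProductSpace n → ℝ} (hf : BddMeas f) {C : ℝ≥0∞}
    (hC : ∀ T : DyadicRect n, (T i).k ≤ κ → ∫⁻ x in dyadicRectSet T,
      ENNReal.ofReal ((f x - blockAvg i (T i).k f x) ^ 2) ≤ C * volume (dyadicRectSet T)) :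
    l2normSq (stoppedOsc Ω i l κ f) ≤ C * volume Ω := by
  calc l2normSq (stoppedOsc Ω i l κ f)
      ≤ ∫⁻ x, ∑ k ∈ Finset.Icc l κ, (stopSet Ω i l κ k).indicator
          (fun x => ENNReal.ofReal ((f x - blockAvg i k f x) ^ 2)) x := by
        refine lintegral_mono fun x => ?_
        by_cases h : ∃ k ∈ Finset.Icc l κ, x ∈ stopSet Ω i l κ k
        · obtain ⟨k, hk, hx⟩ := h
          rw [stoppedOsc_of_mem (Finset.mem_Icc.1 hk).2 hx]
          refine le_trans ?_ (Finset.single_le_sum (fun _ _ => zero_le) hk)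
          rw [Set.indicator_of_mem hx]
        · push Not at h
          have h0 : stoppedOsc Ω i l κ f x = 0 :=
            Finset.sum_eq_zero fun k hk => Set.indicator_of_notMem (h k hk) _
          simp [h0]
    _ = ∑ k ∈ Finset.Icc l κ, ∫⁻ x in stopSet Ω i l κ k,
          ENNReal.ofReal ((f x - blockAvg i k f x) ^ 2) := by
        rw [lintegral_finsetSum _ fun k _ =>
          (hf.sub (hf.blockAvg i k)).measurable_ofReal_sq.indicator measurableSet_stopSet]
        exact Finset.sum_congr rfl fun k _ => lintegral_indicator measurableSet_stopSet _
    _ ≤ ∑ k ∈ Finset.Icc l κ, C * volume (stopSet Ω i l κ k) := by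
        refine Finset.sum_le_sum fun k hk => ?_
        refine setLIntegral_le_of_saturated (update (fun _ => l) i k) measurableSet_stopSet
          (fun x z hxz hx => ?_) (fun T hT => ?_)
        · refine stopSet_of_same_cube (k := k) (by simpa using hxz i) (fun j hj => ?_) le_rfl hx
          simpa [hj] using hxz j
        · have hTi : (T i).k = k := by simpa using hT i
          have h := hC T (by rw [hTi]; exact (Finset.mem_Icc.1 hk).2)
          rwa [hTi] at h
    _ = C * volume (⋃ k ∈ Finset.Icc l κ, stopSet Ω i l κ k) := by
        rw [← Finset.mul_sum, measure_biUnion_finset _ fun _ _ => measurableSet_stopSet]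
        intro k hk k' hk' hne
        refine Set.disjoint_left.2 fun x hx hx' => hne ?_
        exact eq_of_mem_stopSet (Finset.mem_Icc.1 hk).2 (Finset.mem_Icc.1 hk').2 hx hx'
    _ ≤ C * volume Ω := by
        gcongr
        exact Set.iUnion₂_subset fun k _ => Set.sdiff_subset.trans genUnion_subset

lemma tsum_indicator_le_of_small {f : ProductSpace n → ℝ} (hf : BddMeas f) {C : ℝ≥0∞}
    (hC : ∀ T : DyadicRect n, (T i).k ≤ κ → ∫⁻ x in dyadicRectSet T,
      ENNReal.ofReal ((f x - blockAvg i (T i).k f x) ^ 2) ≤ C * volume (dyadicRectSet T)) :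
    ∑' R, {R : DyadicRect n | dyadicRectSet R ⊆ Ω ∧ (R i).k ≤ κ}.indicator
      (fun R => l2normSq (deltaR R f)) R ≤ C * volume Ω := by
  rw [ENNReal.tsum_eq_iSup_sum]
  refine iSup_le fun s => ?_
  obtain ⟨l, hl⟩ : ∃ l : ℤ, ∀ R ∈ s, ∀ j, l ≤ (R j).k := by
    obtain ⟨l, hl⟩ := (s ×ˢ Finset.univ).image (fun p : DyadicRect n × Fin d => (p.1 p.2).k)
      |>.bddBelow
    exact ⟨l, fun R hR j => hl (by
      simp only [Finset.coe_image, Set.mem_image]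
      exact ⟨(R, j), by simpa using hR, rfl⟩)⟩
  calc _ ≤ ∑ R ∈ s, l2normSq (deltaR R (stoppedOsc Ω i l κ f)) := by
        refine Finset.sum_le_sum fun R hR => ?_
        by_cases h : R ∈ {R : DyadicRect n | dyadicRectSet R ⊆ Ω ∧ (R i).k ≤ κ}
        · rw [Set.indicator_of_mem h, deltaR_stoppedOsc hf h.1 h.2 (hl R hR)]
        · rw [Set.indicator_of_notMem h]
          exact zero_le
    _ ≤ _ := ENNReal.sum_le_tsum _
    _ ≤ _ := tsum_l2normSq_deltaR_le hf.stoppedOsc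
    _ ≤ _ := l2normSq_stoppedOsc_le hf hC

end StoppingSets

section ProductEstimate

variable {d : ℕ} {n : Fin d → ℕ}

lemma lintegral_sq_sub_average_le_of_bmo2_le {τ : ProductSpace n → ℝ} {δ : ℝ} (hδ : 0 ≤ δ)
    (h : bmo2 τ ≤ ENNReal.ofReal δ) (T : DyadicRect n) :
    ∫⁻ x in dyadicRectSet T, ENNReal.ofReal ((τ x - ⨍ y in dyadicRectSet T, τ y) ^ 2) ≤
      ENNReal.ofReal (δ ^ 2) * volume (dyadicRectSet T) := by
  let S : Rect n := fun i =>
    ⟨fun t => (T i).j t * 2 ^ (T i).k, 2 ^ (T i).k, by positivity⟩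
  have hS : rectSet S = dyadicRectSet T := by
    ext x
    simp [rectSet, cubeSet, dyadicRectSet, dyadicCubeSet, S, add_mul]
  have h1 := (le_iSup _ S).trans h
  rw [hS, one_div, ENNReal.rpow_inv_le_iff two_pos, ENNReal.rpow_ofNat,
    ← ENNReal.ofReal_pow hδ, mul_comm, ← div_eq_mul_inv] at h1
  exact (ENNReal.div_le_iff (volume_dyadicRectSet_ne_zero T) (volume_dyadicRectSet_ne_top T)).1 h1

lemma abs_update_sub_update_le {φ : ProductSpace n → ℝ} (hφ : ContDiff ℝ 1 φ) (i : Fin d)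
    (hgrad : ∀ x, ∑ j, |fderiv ℝ φ x (Pi.single i (Pi.single j (1 : ℝ)))| ≤ 1)
    (x : ProductSpace n) {c : DyadicCube (n i)} {y q : Fin (n i) → ℝ}
    (hy : y ∈ dyadicCubeSet c) (hq : q ∈ dyadicCubeSet c) :
    |φ (update x i y) - φ (update x i q)| ≤ 2 ^ c.k := by
  have hv : ∀ j, |(y - q) j| ≤ 2 ^ c.k := by
    intro j
    rw [Pi.sub_apply, abs_le]
    constructor <;> linarith [(hy j).1, (hy j).2, (hq j).1, (hq j).2]
  have hdec : (Pi.single i (y - q) : ProductSpace n) =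
      ∑ j, (y - q) j • Pi.single i (Pi.single j (1 : ℝ)) := by
    have h : y - q = ∑ j, (y - q) j • Pi.single j (1 : ℝ) := by
      funext t
      simp [Finset.sum_apply, Pi.single_apply]
    conv_lhs => rw [h]
    simp only [← Pi.single_smul]
    exact map_sum (AddMonoidHom.single (fun i => Fin (n i) → ℝ) i) _ _
  have hder : ∀ z, |fderiv ℝ φ z (Pi.single i (y - q))| ≤ 2 ^ c.k := by
    intro z
    rw [hdec, map_sum]
    calc _ ≤ ∑ j, |fderiv ℝ φ z ((y - q) j • Pi.single i (Pi.single j (1 : ℝ)))| :=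
          Finset.abs_sum_le_sum_abs _ _
      _ ≤ ∑ j, 2 ^ c.k * |fderiv ℝ φ z (Pi.single i (Pi.single j (1 : ℝ)))| := by
          refine Finset.sum_le_sum fun j _ => ?_
          rw [map_smul, smul_eq_mul, abs_mul]
          exact mul_le_mul_of_nonneg_right (hv j) (abs_nonneg _)
      _ ≤ 2 ^ c.k := by
          rw [← Finset.mul_sum]
          exact mul_le_of_le_one_right (by positivity) (hgrad z)
  let γ : ℝ → ProductSpace n := fun t => 
    update x i q + t • (Pi.single i (y - q) : ProductSpace n)
  have hγ : ∀ t, HasDerivAt γ (Pi.single i (y - q)) t := by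
    intro t
    simpa [γ] using ((hasDerivAt_id t).smul_const
      (Pi.single i (y - q) : ProductSpace n)).const_add (update x i q)
  have hcomp : ∀ t, HasDerivAt (φ ∘ γ) (fderiv ℝ φ (γ t) (Pi.single i (y - q))) t := fun t =>
    ((hφ.differentiable one_ne_zero (γ t)).hasFDerivAt).comp_hasDerivAt t (hγ t)
  have h1 : γ 1 = update x i y := by
    funext j
    by_cases h : j = i
    · subst h; simp [γ]
    · simp [γ, h]
  have h0 : γ 0 = update x i q := by simp [γ]
  have := norm_image_sub_le_of_norm_deriv_le_segment_01' (f := φ ∘ γ)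
    (fun t _ => (hcomp t).hasDerivWithinAt) (fun t _ => hder (γ t))
  simpa [h0, h1] using this

lemma mul_sub_mul_sq_le {a b t u s : ℝ} (hab : |a - b| ≤ s) (hb : |b| ≤ 1) (ht : |t| ≤ 1) :
    (a * t - b * u) ^ 2 ≤ 2 * s ^ 2 + 2 * (t - u) ^ 2 := by
  have h1 : ((a - b) * t) ^ 2 ≤ s ^ 2 := by
    rw [← sq_abs, abs_mul]
    exact pow_le_pow_left₀ (by positivity)
      ((mul_le_of_le_one_right (abs_nonneg _) ht).trans hab) 2
  have h2 : (b * (t - u)) ^ 2 ≤ (t - u) ^ 2 := by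
    rw [mul_pow]
    exact mul_le_of_le_one_left (sq_nonneg _) ((sq_le_one_iff_abs_le_one b).2 hb)
  nlinarith [sq_nonneg ((a - b) * t - b * (t - u))]

lemma BddMeas.mul {α : Type*} [MeasurableSpace α] {f g : α → ℝ} (hf : BddMeas f)
    (hg : BddMeas g) : BddMeas fun x => f x * g x := by
  obtain ⟨A, hA0, hA⟩ := hf.exists_nonneg
  obtain ⟨B, -, hB⟩ := hg.exists_nonneg
  refine ⟨hf.meas.mul hg.meas, A * B, fun x => ?_⟩
  rw [abs_mul]
  exact mul_le_mul (hA x) (hB x) (abs_nonneg _) hA0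

/-- The oscillation of `φ * τ` in the block `i` on a dyadic rectangle, for `φ` slowly varying and
`τ` of small mean oscillation. -/
lemma lintegral_mul_sub_blockAvg_sq_le {φ τ : ProductSpace n → ℝ} {s : ℝ} (i : Fin d)
    (hφ : BddMeas φ) (hφ1 : ∀ x, |φ x| ≤ 1) (hτ : Measurable τ) (hτ1 : ∀ x, |τ x| ≤ 1)
    (T : DyadicRect n)
    (hosc : ∀ (x : ProductSpace n) (y q : Fin (n i) → ℝ), y ∈ dyadicCubeSet (T i) →
      q ∈ dyadicCubeSet (T i) → |φ (update x i y) - φ (update x i q)| ≤ s)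
    (hmean : ∫⁻ x in dyadicRectSet T,
      ENNReal.ofReal ((τ x - ⨍ y in dyadicRectSet T, τ y) ^ 2) ≤
        ENNReal.ofReal (s ^ 2) * volume (dyadicRectSet T)) :
    ∫⁻ x in dyadicRectSet T, ENNReal.ofReal
      ((φ x * τ x - blockAvg i (T i).k (fun x => φ x * τ x) x) ^ 2) ≤
        ENNReal.ofReal (4 * s ^ 2) * volume (dyadicRectSet T) := by
  have hτb : BddMeas τ := ⟨hτ, 1, hτ1⟩
  have hf : BddMeas fun x => φ x * τ x := hφ.mul hτb
  set f : ProductSpace n → ℝ := fun x => φ x * τ x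
  set u : ℝ := ⨍ y in dyadicRectSet T, τ y
  have hT := measurableSet_dyadicRectSet T
  have hmeas : Measurable fun x => ENNReal.ofReal (2 * s ^ 2 + 2 * (τ x - u) ^ 2) := by
    fun_prop
  calc ∫⁻ x in dyadicRectSet T, ENNReal.ofReal ((f x - blockAvg i (T i).k f x) ^ 2)
      ≤ ∫⁻ x in dyadicRectSet T, ENNReal.ofReal (2 * s ^ 2 + 2 * (τ x - u) ^ 2) := by
        rw [← lintegral_indicator hT, ← lintegral_indicator hT]
        refine lintegral_mono_block i
          ((hf.sub (hf.blockAvg i _)).measurable_ofReal_sq.indicator hT)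
          (hmeas.indicator hT) fun x => ?_
        by_cases hx : ∀ j, j ≠ i → x j ∈ dyadicCubeSet (T j)
        · have hmem : ∀ y, update x i y ∈ dyadicRectSet T ↔ y ∈ dyadicCubeSet (T i) := by
            intro y
            refine ⟨fun h => by simpa using h i, fun h j => ?_⟩
            by_cases hj : j = i
            · subst hj; simpa using h
            · simpa [hj] using hx j hj
          have hind : ∀ F : ProductSpace n → ℝ≥0∞,
              ∫⁻ y, (dyadicRectSet T).indicator F (update x i y) =
                ∫⁻ y in dyadicCubeSet (T i), F (update x i y) := by
            intro F
            rw [← lintegral_indicator (measurableSet_dyadicCubeSet _)]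
            congr 1
            funext y
            by_cases hy : y ∈ dyadicCubeSet (T i)
            · rw [Set.indicator_of_mem hy, Set.indicator_of_mem ((hmem y).2 hy)]
            · rw [Set.indicator_of_notMem hy, Set.indicator_of_notMem fun h => hy ((hmem y).1 h)]
          obtain ⟨q, hq⟩ : (dyadicCubeSet (T i)).Nonempty :=
            nonempty_of_measure_ne_zero (volume_dyadicCubeSet_ne_zero (T i))
          rw [hind, hind]
          calc _ = ∫⁻ y in dyadicCubeSet (T i), ENNReal.ofReal ((f (update x i y) -
                  ⨍ z in dyadicCubeSet (T i), f (update x i z)) ^ 2) := by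
                refine setLIntegral_congr_fun (measurableSet_dyadicCubeSet _) fun y hy => ?_
                simp only [blockAvg, update_self, update_idem, Ek_of_mem hy]
            _ ≤ ∫⁻ y in dyadicCubeSet (T i), ENNReal.ofReal ((f (update x i y) -
                  φ (update x i q) * u) ^ 2) := by
                rw [lintegral_sq_sub_const (hf.slice i x) (volume_dyadicCubeSet_ne_zero _)
                  (volume_dyadicCubeSet_ne_top _)
                  (φ (update x i q) * u)]
                exact le_self_add
            _ ≤ _ := by
                refine setLIntegral_mono' (measurableSet_dyadicCubeSet _) fun y hy => ?_
                exact ENNReal.ofReal_le_ofReal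
                  (mul_sub_mul_sq_le (hosc x y q hy hq) (hφ1 _) (hτ1 _))
        · push Not at hx
          obtain ⟨j, hj, hxj⟩ := hx
          have h0 : ∀ y, update x i y ∉ dyadicRectSet T := fun y h => hxj (by
            simpa [hj] using h j)
          simp [Set.indicator_of_notMem, h0]
    _ = ENNReal.ofReal (2 * s ^ 2) * volume (dyadicRectSet T) +
          2 * ∫⁻ x in dyadicRectSet T, ENNReal.ofReal ((τ x - u) ^ 2) := by
        rw [← lintegral_const_mul _ (by fun_prop), ← setLIntegral_const,
          ← lintegral_add_left measurable_const]
        congr 1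
        funext x
        rw [ENNReal.ofReal_add (by positivity) (by positivity),
          ENNReal.ofReal_mul (p := 2) (q := (τ x - u) ^ 2) (by norm_num)]
        simp
    _ ≤ ENNReal.ofReal (2 * s ^ 2) * volume (dyadicRectSet T) +
          2 * (ENNReal.ofReal (s ^ 2) * volume (dyadicRectSet T)) := by gcongr
    _ = ENNReal.ofReal (4 * s ^ 2) * volume (dyadicRectSet T) := by
        rw [show 4 * s ^ 2 = 2 * s ^ 2 + 2 * s ^ 2 by ring,
          ENNReal.ofReal_add (by positivity) (by positivity),
          ENNReal.ofReal_mul (p := 2) (by norm_num), add_mul, ENNReal.ofReal_ofNat, mul_assoc]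

lemma l2normSq_mul_le_volume {φ τ : ProductSpace n → ℝ} (hφ1 : ∀ x, |φ x| ≤ 1)
    (hτ : Measurable τ) (hτ1 : ∀ x, |τ x| ≤ 1) :
    l2normSq (fun x => φ x * τ x) ≤ volume {x | τ x ≠ 0} := by
  have hm : MeasurableSet {x | τ x ≠ 0} := (measurableSet_eq_fun hτ measurable_const).compl
  rw [← lintegral_indicator_one hm]
  refine lintegral_mono fun x => ?_
  by_cases h : τ x = 0
  · simp [h]
  · rw [Set.indicator_of_mem (show x ∈ {x | τ x ≠ 0} from h)]
    refine ENNReal.ofReal_le_one.2 ?_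
    rw [sq_le_one_iff_abs_le_one, abs_mul]
    exact mul_le_one₀ (hφ1 x) (abs_nonneg _) (hτ1 x)

lemma prod_le_volume_dyadicRectSet {κ : ℤ} {R : DyadicRect n} (h : ∀ i, κ ≤ (R i).k) :
    ENNReal.ofReal (∏ i, ((2 : ℝ) ^ κ) ^ n i) ≤ volume (dyadicRectSet R) := by
  rw [volume_dyadicRectSet, ENNReal.ofReal_prod_of_nonneg fun _ _ => by positivity]
  refine Finset.prod_le_prod' fun i _ => ?_
  rw [volume_dyadicCubeSet, ENNReal.ofReal_pow (by positivity)]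
  gcongr
  · norm_num
  · exact h i

lemma tsum_subtype_le_sum_tsum_add (Ω : Set (ProductSpace n)) (κ : ℤ)
    (F : DyadicRect n → ℝ≥0∞) :
    ∑' R : {R : DyadicRect n // dyadicRectSet R ⊆ Ω}, F R ≤
      (∑ i, ∑' R, {R : DyadicRect n | dyadicRectSet R ⊆ Ω ∧ (R i).k ≤ κ}.indicator F R) +
        ∑' R, {R : DyadicRect n | dyadicRectSet R ⊆ Ω ∧ ∀ i, κ < (R i).k}.indicator F R := by
  rw [← Summable.tsum_finsetSum fun _ _ => ENNReal.summable, ← ENNReal.tsum_add,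
    show ∑' R : {R : DyadicRect n // dyadicRectSet R ⊆ Ω}, F R =
      ∑' R, {R : DyadicRect n | dyadicRectSet R ⊆ Ω}.indicator F R from tsum_subtype _ F]
  refine ENNReal.tsum_le_tsum fun R => ?_
  by_cases hR : dyadicRectSet R ⊆ Ω
  · rw [Set.indicator_of_mem (show R ∈ {R : DyadicRect n | dyadicRectSet R ⊆ Ω} from hR)]
    by_cases h : ∀ i, κ < (R i).k
    · refine le_add_left ?_
      rw [Set.indicator_of_mem
        (show R ∈ {R : DyadicRect n | dyadicRectSet R ⊆ Ω ∧ ∀ i, κ < (R i).k} from ⟨hR, h⟩)]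
    · push Not at h
      obtain ⟨i, hi⟩ := h
      refine le_add_right (le_trans ?_
        (Finset.single_le_sum (fun _ _ => zero_le) (Finset.mem_univ i)))
      rw [Set.indicator_of_mem
        (show R ∈ {R : DyadicRect n | dyadicRectSet R ⊆ Ω ∧ (R i).k ≤ κ} from ⟨hR, hi⟩)]
  · rw [Set.indicator_of_notMem (show R ∉ {R : DyadicRect n | dyadicRectSet R ⊆ Ω} from hR)]
    exact zero_le

end ProductEstimate

/-- for every `ε > 0` there are `δ, η > 0` such that whenever `φ ∈ C¹`
with `‖φ‖_∞ ≤ 1` and blockwise `ℓ¹` gradient bounds `≤ 1`, and `τ` is measurable with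
`‖τ‖_∞ ≤ 1`, `‖τ‖_{bmo,2} ≤ δ` and `|{τ ≠ 0}| ≤ η`, then `φτ` is in dyadic product BMO
with Carleson constant `ε`: `∑_{R ⊆ Ω} ‖Δ_R(φτ)‖₂² ≤ ε|Ω|` for all open `Ω` of finite
positive measure. -/
theorem statement4 {d : ℕ} (hd : 1 ≤ d) (n : Fin d → ℕ) (hn : ∀ i, 1 ≤ n i)
    (ε : ℝ) (hε : 0 < ε) :
    ∃ δ > (0 : ℝ), ∃ η > (0 : ℝ),
      ∀ φ τ : ProductSpace n → ℝ,
        ContDiff ℝ 1 φ → (∀ x, |φ x| ≤ 1) →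
        (∀ x, ∀ i : Fin d, ∑ j, |fderiv ℝ φ x (Pi.single i (Pi.single j (1 : ℝ)))| ≤ 1) →
        Measurable τ → (∀ x, |τ x| ≤ 1) →
        bmo2 τ ≤ ENNReal.ofReal δ →
        volume {x | τ x ≠ 0} ≤ ENNReal.ofReal η →
        ∀ Ω : Set (ProductSpace n), IsOpen Ω → 0 < volume Ω → volume Ω < ⊤ →
          ∑' R : {R : DyadicRect n // dyadicRectSet R ⊆ Ω},
            l2normSq (deltaR R.1 (fun x => φ x * τ x))
            ≤ ENNReal.ofReal ε * volume Ω := by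
  obtain ⟨m, hm⟩ := exists_pow_lt_of_lt_one
    (show (0 : ℝ) < min 1 (ε / (8 * d)) by positivity) (show (1 / 2 : ℝ) < 1 by norm_num)
  obtain ⟨κ, hκ⟩ : ∃ κ : ℤ, (2 : ℝ) ^ κ = (1 / 2) ^ m := ⟨-m, by simp⟩
  rw [← hκ] at hm
  set s : ℝ := 2 ^ κ
  have hs0 : 0 < s := by positivity
  have hd0 : (0 : ℝ) < d := by exact_mod_cast hd
  have hsmall : d * (4 * s ^ 2) ≤ ε / 2 := by
    have h1 : s ≤ 1 := hm.le.trans (min_le_left _ _)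
    have h2 : s * (8 * d) ≤ ε := (le_div_iff₀ (by positivity)).1 (hm.le.trans (min_le_right _ _))
    nlinarith [mul_nonneg hd0.le (mul_nonneg hs0.le (_root_.sub_nonneg.2 h1))]
  refine ⟨s, hs0, ε / 2 * ∏ i, s ^ n i, by positivity, ?_⟩
  intro φ τ hφ hφ1 hgrad hτ hτ1 hbmo hη Ω _ _ _
  have hφb : BddMeas φ := ⟨hφ.continuous.measurable, 1, hφ1⟩
  have hf : BddMeas fun x => φ x * τ x := hφb.mul ⟨hτ, 1, hτ1⟩
  have hlocal : ∀ i, ∑' R, {R : DyadicRect n | dyadicRectSet R ⊆ Ω ∧ (R i).k ≤ κ}.indicator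
      (fun R => l2normSq (deltaR R fun x => φ x * τ x)) R ≤
        ENNReal.ofReal (4 * s ^ 2) * volume Ω := fun i =>
    tsum_indicator_le_of_small hf fun T hT =>
      lintegral_mul_sub_blockAvg_sq_le i hφb hφ1 hτ hτ1 T
        (fun x y q hy hq => (abs_update_sub_update_le hφ i (fun z => hgrad z i) x hy hq).trans
          (zpow_le_zpow_right₀ (by norm_num) hT))
        (lintegral_sq_sub_average_le_of_bmo2_le hs0.le hbmo T)
  have hlarge : ∑' R, {R : DyadicRect n | dyadicRectSet R ⊆ Ω ∧ ∀ i, κ < (R i).k}.indicator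
      (fun R => l2normSq (deltaR R fun x => φ x * τ x)) R ≤ ENNReal.ofReal (ε / 2) * volume Ω := by
    rcases Set.eq_empty_or_nonempty
      {R : DyadicRect n | dyadicRectSet R ⊆ Ω ∧ ∀ i, κ < (R i).k} with h | ⟨R, hR, hRk⟩
    · simp [h]
    · calc _ ≤ ∑' R, l2normSq (deltaR R fun x => φ x * τ x) :=
            ENNReal.tsum_le_tsum fun _ => Set.indicator_le_self _
              (fun R => l2normSq (deltaR R fun x => φ x * τ x)) _
        _ ≤ ENNReal.ofReal (ε / 2 * ∏ i, s ^ n i) :=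
            (tsum_l2normSq_deltaR_le hf).trans ((l2normSq_mul_le_volume hφ1 hτ hτ1).trans hη)
        _ ≤ ENNReal.ofReal (ε / 2) * volume Ω := by
            rw [ENNReal.ofReal_mul (by positivity)]
            gcongr
            exact (prod_le_volume_dyadicRectSet fun i => (hRk i).le).trans (measure_mono hR)
  calc _ ≤ _ := tsum_subtype_le_sum_tsum_add Ω κ _
    _ ≤ (∑ _i : Fin d, ENNReal.ofReal (4 * s ^ 2) * volume Ω) +
          ENNReal.ofReal (ε / 2) * volume Ω :=
        add_le_add (Finset.sum_le_sum fun i _ => hlocal i) hlarge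
    _ = ENNReal.ofReal (d * (4 * s ^ 2) + ε / 2) * volume Ω := by
        rw [ENNReal.ofReal_add (by positivity) (by positivity), add_mul,
          ENNReal.ofReal_mul (p := (d : ℝ)) (by positivity)]
        simp [mul_assoc]
    _ ≤ ENNReal.ofReal ε * volume Ω := by
        gcongr
        linarith
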